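/- There is a constant C > 0 such that for every measurable function φ : (0,∞) → ℂ, every A > 0 with |φ(t)| ≤ A for almost every t > 0, and all x, y ∈ ℝ with xy < 0, one has |K_φ^H(x,y)| ≤ C · A/(|x| + |y|). -/

import Mathlib

open MeasureTheory Set

/-- The Hermite heat kernel `W_t^H(x,y)`. -/
noncomputable def WH (t x y : ℝ) : ℝ :=
  (1 / Real.sqrt Real.pi) * Real.sqrt (Real.exp (-t) / (1 - Real.exp (-2*t))) *
    Real.exp (-(((x - Real.exp (-t) * y)^2 + (y - Real.exp (-t) * x)^2) /
      (2 * (1 - Real.exp (-2*t)))))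

/-- The kernel `K_φ^H(x,y) = ∫_0^∞ φ(t) (-∂_t W_t^H(x,y)) dt`. -/
noncomputable def KH (φ : ℝ → ℂ) (x y : ℝ) : ℂ :=
  ∫ t in Set.Ioi (0:ℝ), φ t * ((-(deriv (fun s => WH s x y) t) : ℝ) : ℂ)

/-- The Hermite heat kernel written with hyperbolic functions. -/
lemma WH_eq_sinh {t : ℝ} (ht : 0 < t) (x y : ℝ) :
    WH t x y = (1 / Real.sqrt Real.pi) * ((Real.sqrt (2 * Real.sinh t))⁻¹ *
      Real.exp (-(((x ^ 2 + y ^ 2) / 2 * Real.cosh t - x * y) / Real.sinh t))) := by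
  have hr : Real.exp (-t) < 1 := by simpa using ht
  have hr0 := Real.exp_pos (-t)
  have h2 : Real.exp (-2 * t) = Real.exp (-t) ^ 2 := by
    rw [← Real.exp_nat_mul]; congr 1; push_cast; ring
  have he : Real.exp t = (Real.exp (-t))⁻¹ := by rw [Real.exp_neg, inv_inv]
  unfold WH
  rw [mul_assoc, h2, Real.sinh_eq, Real.cosh_eq, he]
  generalize Real.exp (-t) = r at *
  have hd : 0 < 1 - r ^ 2 := by nlinarith
  have hs : r⁻¹ - r = (1 - r ^ 2) / r := by field_simp
  have hc : r⁻¹ + r = (1 + r ^ 2) / r := by field_simp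
  congr 2
  · rw [hs, ← Real.sqrt_inv]
    congr 1
    field_simp
  · rw [hs, hc]
    congr 2
    field_simp
    ring

lemma hasDerivAt_WH {t : ℝ} (ht : 0 < t) (x y : ℝ) :
    HasDerivAt (fun s => WH s x y)
      ((1 / Real.sqrt Real.pi) * ((Real.sqrt (2 * Real.sinh t))⁻¹ *
        Real.exp (-(((x ^ 2 + y ^ 2) / 2 * Real.cosh t - x * y) / Real.sinh t)) *
        (((x ^ 2 + y ^ 2) / 2 - x * y * Real.cosh t) / Real.sinh t ^ 2 -
          Real.cosh t / (2 * Real.sinh t)))) t := by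
  have hu : 0 < Real.sinh t := Real.sinh_pos_iff.2 ht
  have hq : 0 < Real.sqrt (2 * Real.sinh t) := Real.sqrt_pos.2 (by positivity)
  have hq2 : Real.sqrt (2 * Real.sinh t) ^ 2 = 2 * Real.sinh t := Real.sq_sqrt (by positivity)
  have hcs := Real.cosh_sq t
  have h1 := (((Real.hasDerivAt_sinh t).const_mul 2).sqrt (by positivity)).inv hq.ne'
  have h2 := (((((Real.hasDerivAt_cosh t).const_mul ((x ^ 2 + y ^ 2) / 2)).sub_const
    (x * y)).div (Real.hasDerivAt_sinh t) hu.ne').neg).exp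
  have h3 := (h1.mul h2).const_mul (1 / Real.sqrt Real.pi)
  have heq : (fun s => WH s x y) =ᶠ[nhds t] _ :=
    Filter.eventually_of_mem (Ioi_mem_nhds ht) fun s hs => WH_eq_sinh hs x y
  refine HasDerivAt.congr_of_eventuallyEq (h3.congr_deriv ?_) heq
  simp only [Pi.neg_apply, Pi.div_apply, Pi.inv_apply]
  generalize Real.exp _ = e
  rw [mul_right_inj' (by positivity)]
  have hA : ((x ^ 2 + y ^ 2) / 2 * Real.sinh t * Real.sinh t -
      ((x ^ 2 + y ^ 2) / 2 * Real.cosh t - x * y) * Real.cosh t) =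
      -((x ^ 2 + y ^ 2) / 2 - x * y * Real.cosh t) := by
    linear_combination (-(x ^ 2 + y ^ 2) / 2) * hcs
  rw [hA, hq2]
  field_simp
  ring

lemma sinh_profile_bound {S u : ℝ} (hS : 0 < S) (hu : 0 < u) :
    (Real.sqrt (2 * u))⁻¹ * Real.exp (-(S / (2 * u))) * ((u + 2 * S) / (2 * u ^ 2)) ≤
      216 * ((S + u) * Real.sqrt (S + u))⁻¹ := by
  obtain ⟨v, hv, rfl⟩ : ∃ v, 0 < v ∧ S = u * v := ⟨S / u, by positivity, by field_simp⟩
  have ha : 0 < Real.sqrt (2 * u) := Real.sqrt_pos.2 (by positivity)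
  have hq : 0 < Real.sqrt (u * v + u) := Real.sqrt_pos.2 (by positivity)
  have hqa : Real.sqrt (u * v + u) ≤ Real.sqrt (2 * u) * (1 + v) := by
    rw [Real.sqrt_le_left (by positivity), mul_pow, Real.sq_sqrt (by positivity)]
    nlinarith [mul_pos hu hv, mul_pos (mul_pos hu hv) hv]
  have hexp : (1 + v) ^ 3 ≤ 216 * Real.exp (v / 2) := by
    have h : Real.exp (v / 2) = Real.exp (v / 6) ^ 3 := by
      rw [← Real.exp_nat_mul]; congr 1; push_cast; ring
    have h1 : 1 + v ≤ 6 * Real.exp (v / 6) := by linarith [Real.add_one_le_exp (v / 6)]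
    calc (1 + v) ^ 3 ≤ (6 * Real.exp (v / 6)) ^ 3 := by gcongr
      _ = 216 * Real.exp (v / 2) := by rw [h]; ring
  have hv2 : u * v / (2 * u) = v / 2 := by field_simp
  have hfrac : (u + 2 * (u * v)) / (2 * u ^ 2) ≤ (1 + v) / u := by
    rw [div_le_div_iff₀ (by positivity) hu]
    nlinarith [pow_pos hu 2, pow_pos hu 3]
  rw [hv2, Real.exp_neg]
  refine (mul_le_mul_of_nonneg_left hfrac (by positivity)).trans ?_
  rw [← div_eq_mul_inv 216, le_div_iff₀ (by positivity)]
  have hE := Real.exp_pos (v / 2)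
  calc (Real.sqrt (2 * u))⁻¹ * (Real.exp (v / 2))⁻¹ * ((1 + v) / u) *
        ((u * v + u) * Real.sqrt (u * v + u))
      ≤ (Real.sqrt (2 * u))⁻¹ * (Real.exp (v / 2))⁻¹ * ((1 + v) / u) *
        ((u * v + u) * (Real.sqrt (2 * u) * (1 + v))) := by gcongr
    _ = (1 + v) ^ 3 / Real.exp (v / 2) := by field_simp; ring
    _ ≤ 216 := by rwa [div_le_iff₀ hE]

lemma abs_deriv_WH_le {t x y : ℝ} (ht : 0 < t) (hxy : x * y < 0) :
    |deriv (fun s => WH s x y) t| ≤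
      216 * (Real.cosh t * ((x ^ 2 + y ^ 2 + Real.sinh t) *
        Real.sqrt (x ^ 2 + y ^ 2 + Real.sinh t))⁻¹) := by
  rw [(hasDerivAt_WH ht x y).deriv]
  have hu : 0 < Real.sinh t := Real.sinh_pos_iff.2 ht
  have hc : 1 ≤ Real.cosh t := Real.one_le_cosh t
  have hS : 0 < x ^ 2 + y ^ 2 := by nlinarith [sq_nonneg (x + y)]
  have hP : -(x * y) ≤ (x ^ 2 + y ^ 2) / 2 := by nlinarith [sq_nonneg (x + y)]
  have hprof := sinh_profile_bound hS hu
  have hpi : 1 / Real.sqrt Real.pi ≤ 1 := by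
    rw [div_le_one (Real.sqrt_pos.2 Real.pi_pos), Real.one_le_sqrt]
    linarith [Real.pi_gt_three]
  generalize x ^ 2 + y ^ 2 = S at *
  generalize x * y = p at *
  generalize Real.sinh t = u at *
  generalize Real.cosh t = c at *
  have hexp : Real.exp (-((S / 2 * c - p) / u)) ≤ Real.exp (-(S / (2 * u))) := by
    have h : S / (2 * u) = (S / 2) / u := by field_simp
    rw [h]
    gcongr
    nlinarith
  have hD : |(S / 2 - p * c) / u ^ 2 - c / (2 * u)| ≤ c * ((u + 2 * S) / (2 * u ^ 2)) := by
    have hb : S / 2 - p * c ≤ S * c := by nlinarith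
    have hb0 : 0 ≤ S / 2 - p * c := by nlinarith
    have h1 : (S / 2 - p * c) / u ^ 2 ≤ S * c / u ^ 2 := by gcongr
    have h2 : 0 ≤ (S / 2 - p * c) / u ^ 2 := by positivity
    have h3 : c * ((u + 2 * S) / (2 * u ^ 2)) = S * c / u ^ 2 + c / (2 * u) := by
      field_simp
      ring
    have h4 : 0 ≤ c / (2 * u) := by positivity
    rw [h3, abs_le]
    constructor <;> linarith
  have hnn : 0 ≤ (Real.sqrt (2 * u))⁻¹ := by positivity
  rw [abs_mul, abs_mul, abs_mul, abs_of_nonneg hnn, Real.abs_exp,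
    abs_of_nonneg (by positivity : 0 ≤ 1 / Real.sqrt Real.pi)]
  calc 1 / Real.sqrt Real.pi * ((Real.sqrt (2 * u))⁻¹ * Real.exp (-((S / 2 * c - p) / u)) *
        |(S / 2 - p * c) / u ^ 2 - c / (2 * u)|)
      ≤ 1 * ((Real.sqrt (2 * u))⁻¹ * Real.exp (-(S / (2 * u))) *
        (c * ((u + 2 * S) / (2 * u ^ 2)))) := by gcongr
    _ = c * ((Real.sqrt (2 * u))⁻¹ * Real.exp (-(S / (2 * u))) *
        ((u + 2 * S) / (2 * u ^ 2))) := by ring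
    _ ≤ c * (216 * ((S + u) * Real.sqrt (S + u))⁻¹) := by gcongr
    _ = _ := by ring

lemma hasDerivAt_neg_two_div_sqrt_add_sinh {S t : ℝ} (hS : 0 < S) (ht : 0 ≤ t) :
    HasDerivAt (fun s => -2 * (Real.sqrt (S + Real.sinh s))⁻¹)
      (Real.cosh t * ((S + Real.sinh t) * Real.sqrt (S + Real.sinh t))⁻¹) t := by
  have hu : 0 ≤ Real.sinh t := Real.sinh_nonneg_iff.2 ht
  have hp : 0 < S + Real.sinh t := by positivity
  have hq := Real.sqrt_pos.2 hp
  refine (((((Real.hasDerivAt_sinh t).const_add S).sqrt hp.ne').inv hq.ne').const_mul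
    (-2)).congr_deriv ?_
  rw [Real.sq_sqrt hp.le]
  field_simp

lemma tendsto_neg_two_div_sqrt_add_sinh (S : ℝ) :
    Filter.Tendsto (fun s => -2 * (Real.sqrt (S + Real.sinh s))⁻¹) Filter.atTop (nhds 0) := by
  have hsinh : Filter.Tendsto Real.sinh Filter.atTop Filter.atTop :=
    Filter.tendsto_atTop_mono' _ (Filter.eventually_atTop.2
      ⟨0, fun t ht => Real.self_le_sinh_iff.2 ht⟩) Filter.tendsto_id
  simpa using ((Real.tendsto_sqrt_atTop.comp
    (Filter.tendsto_atTop_add_const_left _ S hsinh)).inv_tendsto_atTop).const_mul (-2)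

theorem hermite_kernel_opposite_signs_estimate :
    ∃ C > (0:ℝ), ∀ (φ : ℝ → ℂ) (A : ℝ), Measurable φ → 0 < A →
      (∀ᵐ t ∂(volume.restrict (Set.Ioi (0:ℝ))), ‖φ t‖ ≤ A) →
      ∀ x y : ℝ, x * y < 0 →
        ‖KH φ x y‖ ≤ C * A / (|x| + |y|) := by
  refine ⟨864, by norm_num, fun φ A _ hA hφ x y hxy => ?_⟩
  have hS : 0 < x ^ 2 + y ^ 2 := by nlinarith [sq_nonneg (x + y)]
  have hderiv : ∀ t ∈ Ici (0:ℝ), HasDerivAt _ _ t := fun t ht =>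
    hasDerivAt_neg_two_div_sqrt_add_sinh hS ht
  have hlim := tendsto_neg_two_div_sqrt_add_sinh (x ^ 2 + y ^ 2)
  have hint := integrableOn_Ioi_deriv_of_nonneg' hderiv (fun t ht => by
    have := Real.sinh_pos_iff.2 ht
    have := Real.cosh_pos t
    positivity) hlim
  have hval := integral_Ioi_of_hasDerivAt_of_tendsto' hderiv hint hlim
  have hbound : ‖KH φ x y‖ ≤ ∫ t in Ioi (0:ℝ), A * 216 * (Real.cosh t *
      ((x ^ 2 + y ^ 2 + Real.sinh t) * Real.sqrt (x ^ 2 + y ^ 2 + Real.sinh t))⁻¹) := by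
    refine norm_integral_le_of_norm_le (hint.const_mul _) ?_
    filter_upwards [hφ, ae_restrict_mem measurableSet_Ioi] with t h1 ht
    rw [norm_mul, Complex.norm_real, norm_neg, Real.norm_eq_abs, mul_assoc A]
    exact mul_le_mul h1 (abs_deriv_WH_le ht hxy) (abs_nonneg _) hA.le
  rw [integral_const_mul, hval] at hbound
  refine hbound.trans ?_
  have hq := Real.sqrt_pos.2 hS
  have hx : 0 < |x| := abs_pos.2 (left_ne_zero_of_mul hxy.ne)
  have hsum : |x| + |y| ≤ 2 * Real.sqrt (x ^ 2 + y ^ 2) := by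
    have h1 := Real.abs_le_sqrt (show x ^ 2 ≤ x ^ 2 + y ^ 2 by nlinarith [sq_nonneg y])
    have h2 := Real.abs_le_sqrt (show y ^ 2 ≤ x ^ 2 + y ^ 2 by nlinarith [sq_nonneg x])
    linarith
  have hle : (Real.sqrt (x ^ 2 + y ^ 2))⁻¹ ≤ 2 / (|x| + |y|) := by
    rw [inv_eq_one_div, div_le_div_iff₀ hq (by positivity)]
    linarith
  rw [Real.sinh_zero, add_zero]
  calc A * 216 * (0 - -2 * (Real.sqrt (x ^ 2 + y ^ 2))⁻¹)
      = 432 * A * (Real.sqrt (x ^ 2 + y ^ 2))⁻¹ := by ring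
    _ ≤ 432 * A * (2 / (|x| + |y|)) := by gcongr
    _ = 864 * A / (|x| + |y|) := by ring
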